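/- For every m ∈ (1,2] and every β > 𝓛(m), the Hausdorff dimension of the set π_β(U_β(m)) ⊆ ℝ is positive. -/

import Mathlib

/-- `π_β(u)` for a binary sequence `u = u₁u₂⋯` (indexed from 0). -/
noncomputable def piB (β : ℝ) (u : ℕ → Bool) : ℝ :=
  ∑' k : ℕ, (if u k then (1 : ℝ) else 0) / β ^ (k + 1)

/-- `π_β(u)` for a real digit sequence. -/
noncomputable def piR (β : ℝ) (u : ℕ → ℝ) : ℝ := ∑' k : ℕ, u k / β ^ (k + 1)

/-- A binary sequence viewed as a real digit sequence. -/
def bR (u : ℕ → Bool) : ℕ → ℝ := fun k => if u k then 1 else 0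

/-- `U_β(A)`: sequences with digits in `A` whose `π_β`-value has no other expansion over `A`. -/
def Uset (β : ℝ) (A : Set ℝ) : Set (ℕ → ℝ) :=
  {u | (∀ k, u k ∈ A) ∧ ∀ v : ℕ → ℝ, (∀ k, v k ∈ A) → v ≠ u → piR β v ≠ piR β u}

/-- `𝓛(m) = inf {β > 1 : U_β(m) ∩ {0,1}^ℕ is uncountable}`. -/
noncomputable def Lval (m : ℝ) : ℝ :=
  sInf {β : ℝ | 1 < β ∧ ¬ (Uset β {0, 1, m} ∩ {v | ∃ u : ℕ → Bool, v = bR u}).Countable}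

/-- The shift orbit `O(u)` of an infinite binary word. -/
def orbit (u : ℕ → Bool) : Set (ℕ → Bool) := {v | ∃ k : ℕ, v = fun i => u (i + k)}

/-- Suffixes of `u` preceded by the letter `1`. -/
def orbit1 (u : ℕ → Bool) : Set (ℕ → Bool) :=
  {v | ∃ k : ℕ, u k = true ∧ v = fun i => u (i + k + 1)}

/-- Suffixes of `u` preceded by the letter `0`. -/
def orbit0 (u : ℕ → Bool) : Set (ℕ → Bool) :=
  {v | ∃ k : ℕ, u k = false ∧ v = fun i => u (i + k + 1)}

open Classical in
/-- The lexicographic supremum of a set of binary sequences (greedy construction);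
`⊥ = 0̄` for the empty set. -/
noncomputable def lexSupSeq (S : Set (ℕ → Bool)) : ℕ → Bool
  | n => decide (∃ u ∈ S, (∀ i, i < n → u i = lexSupSeq S i) ∧ u n = true)
  termination_by n => n

open Classical in
/-- The lexicographic infimum of a set of binary sequences (greedy construction);
`⊤ = 1̄` for the empty set. -/
noncomputable def lexInfSeq (S : Set (ℕ → Bool)) : ℕ → Bool
  | n => decide (¬ ∃ u ∈ S, (∀ i, i < n → u i = lexInfSeq S i) ∧ u n = false)
  termination_by n => n

/-- `sup O(u)`, the lexicographically largest limit of suffixes of `u`. -/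
noncomputable def supO (u : ℕ → Bool) : ℕ → Bool := lexSupSeq (orbit u)
/-- `inf O(u)`. -/
noncomputable def infO (u : ℕ → Bool) : ℕ → Bool := lexInfSeq (orbit u)
/-- `sup₀(u)`, the supremum of the suffixes preceded by `0`. -/
noncomputable def sup0 (u : ℕ → Bool) : ℕ → Bool := lexSupSeq (orbit0 u)
/-- `inf₁(u)`, the infimum of the suffixes preceded by `1`. -/
noncomputable def inf1 (u : ℕ → Bool) : ℕ → Bool := lexInfSeq (orbit1 u)

/-- Strict lexicographic order on infinite binary words. -/
def lexLt (u v : ℕ → Bool) : Prop := ∃ n, (∀ i, i < n → u i = v i) ∧ u n < v n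
/-- Lexicographic order on infinite binary words. -/
def lexLe (u v : ℕ → Bool) : Prop := lexLt u v ∨ u = v

/-- `f_u(m)`: the unique `β ≥ 1` with `β·π_β(sup O(u)) = m`. -/
noncomputable def fVal (u : ℕ → Bool) (m : ℝ) : ℝ :=
  sInf {β : ℝ | 1 ≤ β ∧ β * piB β (supO u) = m}

/-- `g_u(m)`: the unique `β > 1` with `(β-1)(1+π_β(inf O(u))) = m`. -/
noncomputable def gVal (u : ℕ → Bool) (m : ℝ) : ℝ :=
  sInf {β : ℝ | 1 < β ∧ (β - 1) * (1 + piB β (infO u)) = m}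

/-- `μ_u`: the unique `m ∈ (1,2]` with `f_u(m) = g_u(m)`. -/
noncomputable def muVal (u : ℕ → Bool) : ℝ :=
  sInf {m : ℝ | 1 < m ∧ m ≤ 2 ∧ fVal u m = gVal u m}

/-- `u` contains at least two ones. -/
def TwoOnes (u : ℕ → Bool) : Prop := ∃ k l, k < l ∧ u k = true ∧ u l = true

/-- The substitution `L : 0 ↦ 0, 1 ↦ 01` (with `0 = false`, `1 = true`). -/
def Lsub : Bool → List Bool := fun b => if b then [false, true] else [false]
/-- The substitution `M : 0 ↦ 01, 1 ↦ 10`. -/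
def Msub : Bool → List Bool := fun b => if b then [true, false] else [false, true]
/-- The substitution `R : 0 ↦ 01, 1 ↦ 1`. -/
def Rsub : Bool → List Bool := fun b => if b then [true] else [false, true]
/-- The identity substitution. -/
def idSub : Bool → List Bool := fun b => [b]
/-- Composition of substitutions: `compSub σ τ = σ ∘ τ` (apply `τ` first). -/
def compSub (σ τ : Bool → List Bool) : Bool → List Bool := fun b => (τ b).flatMap σ

/-- The monoid `{L,M,R}*` generated by the three substitutions. -/
def LMRstar : Set (Bool → List Bool) :=
  {σ | ∃ l : List (Bool → List Bool),
    (∀ τ ∈ l, τ = Lsub ∨ τ = Msub ∨ τ = Rsub) ∧ σ = l.foldr compSub idSub}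

/-- A substitution applied to an infinite word, `σ(u₁)σ(u₂)⋯`. -/
noncomputable def substApply (σ : Bool → List Bool) (u : ℕ → Bool) : ℕ → Bool := fun n =>
  let k := sSup {k : ℕ | (∑ i ∈ Finset.range k, (σ (u i)).length) ≤ n}
  (σ (u k)).getD (n - ∑ i ∈ Finset.range k, (σ (u i)).length) false

/-- `u` is a limit word of the sequence of substitutions `σseq`. -/
def IsLimitWord (σseq : ℕ → Bool → List Bool) (u : ℕ → Bool) : Prop :=
  ∃ useq : ℕ → ℕ → Bool, useq 0 = u ∧ ∀ n, useq n = substApply (σseq n) (useq (n + 1))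

/-- Primitivity of a sequence of substitutions in `{L,M,R}^ℕ`: no tail is constantly `L`
and no tail is constantly `R`. -/
def PrimitiveSeq (σseq : ℕ → Bool → List Bool) : Prop :=
  (¬ ∃ k, ∀ n, k ≤ n → σseq n = Lsub) ∧ ¬ ∃ k, ∀ n, k ≤ n → σseq n = Rsub

/-- `S_{L,M,R}`: the set of limit words of primitive sequences of substitutions. -/
def Sset : Set (ℕ → Bool) :=
  {u | ∃ σseq : ℕ → Bool → List Bool,
    (∀ n, σseq n = Lsub ∨ σseq n = Msub ∨ σseq n = Rsub) ∧
    PrimitiveSeq σseq ∧ IsLimitWord σseq u}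

/-- The word `1 0̄ = 1000⋯`. -/
def w10bar : ℕ → Bool := fun n => decide (n = 0)
/-- The word `0 1̄ = 0111⋯`. -/
def w01bar : ℕ → Bool := fun n => decide (n ≠ 0)
/-- The word `01 0̄ = 01000⋯`. -/
def w010bar : ℕ → Bool := fun n => decide (n = 1)
/-- The word `10 1̄ = 10111⋯`. -/
def w101bar : ℕ → Bool := fun n => decide (n ≠ 1)
/-- The word `0̄`. -/
def w0bar : ℕ → Bool := fun _ => false
/-- The word `1̄`. -/
def w1bar : ℕ → Bool := fun _ => true

/-- Prepend a letter to an infinite word. -/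
def consB (b : Bool) (u : ℕ → Bool) : ℕ → Bool := fun n =>
  match n with
  | 0 => b
  | Nat.succ k => u k

/-- Prepend a finite word to an infinite word. -/
def appendW (w : List Bool) (v : ℕ → Bool) : ℕ → Bool := fun n =>
  if n < w.length then w.getD n false else v (n - w.length)

/-! ### Expansions with bounded digits -/

section Expansions

variable {β M : ℝ} {d e : ℕ → ℝ}

theorem hasSum_const_div_pow (hβ : 1 < β) (M : ℝ) :
    HasSum (fun k : ℕ => M / β ^ (k + 1)) (M / (β - 1)) := by
  have h := (hasSum_geometric_of_lt_one (r := β⁻¹) (by positivity)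
    (inv_lt_one_of_one_lt₀ hβ)).mul_left (M * β⁻¹)
  have h1 : β ≠ 0 := by linarith
  have h2 : M / (β - 1) = M * β⁻¹ * (1 - β⁻¹)⁻¹ := by
    rw [mul_assoc, ← mul_inv, mul_sub, mul_inv_cancel₀ h1, mul_one, div_eq_mul_inv]
  have h3 : (fun k : ℕ => M / β ^ (k + 1)) = fun k => M * β⁻¹ * β⁻¹ ^ k := by
    ext k
    rw [pow_succ, inv_pow]
    field_simp
  rw [h2, h3]
  exact h

theorem summable_digits (hβ : 1 < β) (hd : ∀ k, 0 ≤ d k ∧ d k ≤ M) :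
    Summable fun k : ℕ => d k / β ^ (k + 1) :=
  Summable.of_nonneg_of_le (fun k => div_nonneg (hd k).1 (by positivity))
    (fun k => div_le_div_of_nonneg_right (hd k).2 (by positivity))
    (hasSum_const_div_pow hβ M).summable

theorem piR_nonneg (hβ : 1 < β) (hd : ∀ k, 0 ≤ d k) : 0 ≤ piR β d :=
  tsum_nonneg fun k => div_nonneg (hd k) (by positivity)

theorem piR_le (hβ : 1 < β) (hd : ∀ k, 0 ≤ d k ∧ d k ≤ M) : piR β d ≤ M / (β - 1) := by
  rw [← (hasSum_const_div_pow hβ M).tsum_eq]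
  exact (summable_digits hβ hd).tsum_le_tsum
    (fun k => div_le_div_of_nonneg_right (hd k).2 (by positivity))
    (hasSum_const_div_pow hβ M).summable

theorem piR_split (hβ : 1 < β) (hd : ∀ k, 0 ≤ d k ∧ d k ≤ M) (k : ℕ) :
    piR β d = ∑ i ∈ Finset.range k, d i / β ^ (i + 1) + piR β (fun i => d (i + k)) / β ^ k := by
  rw [piR, ← (summable_digits hβ hd).sum_add_tsum_nat_add k, piR, ← tsum_div_const]
  congr 1
  refine tsum_congr fun i => ?_
  rw [div_div, ← pow_add]
  congr 2
  omega

theorem piR_succ (hβ : 1 < β) (hd : ∀ k, 0 ≤ d k ∧ d k ≤ M) :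
    piR β d = (d 0 + piR β (fun i => d (i + 1))) / β := by
  rw [piR_split hβ hd 1]
  simp [add_div]

theorem piR_sub_of_agree (hβ : 1 < β) (hd : ∀ k, 0 ≤ d k ∧ d k ≤ M)
    (he : ∀ k, 0 ≤ e k ∧ e k ≤ M) {k : ℕ} (h : ∀ i < k, d i = e i) :
    piR β d - piR β e = (piR β (fun i => d (i + k)) - piR β (fun i => e (i + k))) / β ^ k := by
  rw [piR_split hβ hd k, piR_split hβ he k,
    Finset.sum_congr rfl fun i hi => by rw [h i (Finset.mem_range.1 hi)]]
  ring

theorem piR_sub_of_agree_succ (hβ : 1 < β) (hd : ∀ k, 0 ≤ d k ∧ d k ≤ M)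
    (he : ∀ k, 0 ≤ e k ∧ e k ≤ M) {k : ℕ} (h : ∀ i < k, d i = e i) :
    piR β d - piR β e = (d k + piR β (fun i => d (i + (k + 1))) -
      (e k + piR β (fun i => e (i + (k + 1))))) / β ^ (k + 1) := by
  rw [piR_sub_of_agree hβ hd he h, piR_succ hβ fun i => hd (i + k),
    piR_succ hβ fun i => he (i + k), pow_succ', ← sub_div, div_div]
  simp only [zero_add, add_assoc, add_comm 1 k]

theorem piR_le_mul_piR {β' : ℝ} (hβ' : 1 < β') (h : β' ≤ β) (hd : ∀ k, 0 ≤ d k ∧ d k ≤ M) :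
    piR β d ≤ β' / β * piR β' d := by
  have hβ : 1 < β := hβ'.trans_le h
  rw [piR, piR, ← tsum_mul_left]
  refine (summable_digits hβ hd).tsum_le_tsum (fun k => ?_)
    ((summable_digits hβ' hd).mul_left _)
  have h1 : β' ^ k ≤ β ^ k := pow_le_pow_left₀ (by linarith) h k
  have h2 : β' / β * (d k / β' ^ (k + 1)) = d k / (β * β' ^ k) := by
    rw [pow_succ]
    field_simp
  rw [h2, pow_succ']
  exact div_le_div_of_nonneg_left (hd k).1 (by positivity) (by gcongr)

theorem exists_first_ne {α : Type*} {u v : ℕ → α} (h : u ≠ v) :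
    ∃ k, (∀ i < k, u i = v i) ∧ u k ≠ v k := by
  classical
  have h' : ∃ k, u k ≠ v k := Function.ne_iff.1 h
  exact ⟨Nat.find h', fun i hi => not_not.1 (Nat.find_min h' hi), Nat.find_spec h'⟩

theorem digit_bounds {m : ℝ} (hm : 1 < m) (hd : ∀ k, d k ∈ ({0, 1, m} : Set ℝ)) (k : ℕ) :
    0 ≤ d k ∧ d k ≤ m := by
  rcases hd k with h | h | h <;> rw [h] <;> constructor <;> linarith

theorem bR_bounds (y : ℕ → Bool) (k : ℕ) : 0 ≤ bR y k ∧ bR y k ≤ 1 := by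
  unfold bR
  split_ifs <;> norm_num

theorem bR_mem (m : ℝ) (y : ℕ → Bool) (k : ℕ) : bR y k ∈ ({0, 1, m} : Set ℝ) := by
  unfold bR
  split_ifs <;> simp

/-- Every point of `[0, m/(β-1)]` has an expansion over `{0,1,m}` if `β ≤ 1 + m`. -/
theorem exists_expansion {m : ℝ} (hm : 1 < m) (hm2 : m ≤ 2) (hβ : 1 < β) (hβm : β ≤ 1 + m)
    {x : ℝ} (hx0 : 0 ≤ x) (hx : x ≤ m / (β - 1)) :
    ∃ d : ℕ → ℝ, (∀ k, d k ∈ ({0, 1, m} : Set ℝ)) ∧ piR β d = x := by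
  have hβ1 : 0 < β - 1 := by linarith
  set K := m / (β - 1) with hK
  have hKm : K * β = K + m := by rw [hK]; field_simp; ring
  have hK1 : 1 ≤ K := by rw [hK, le_div_iff₀ hβ1]; linarith
  have step : ∀ t : ℝ, ∃ a ∈ ({0, 1, m} : Set ℝ), t ∈ Set.Icc 0 K → β * t - a ∈ Set.Icc 0 K := by
    intro t
    by_cases ht : t ∈ Set.Icc 0 K
    · have h0 : 0 ≤ β * t := mul_nonneg (by linarith) ht.1
      have h1 : β * t ≤ β * K := mul_le_mul_of_nonneg_left ht.2 (by linarith)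
      by_cases c1 : β * t ≤ K
      · exact ⟨0, by simp, fun _ => ⟨by linarith, by linarith⟩⟩
      by_cases c2 : β * t ≤ K + 1
      · exact ⟨1, by simp, fun _ => ⟨by linarith, by linarith⟩⟩
      · exact ⟨m, by simp, fun _ => ⟨by linarith, by linarith⟩⟩
    · exact ⟨0, by simp, fun h => absurd h ht⟩
  choose g hg hgs using step
  let s : ℕ → ℝ := fun n => (fun t => β * t - g t)^[n] x
  have hs : ∀ n, s (n + 1) = β * s n - g (s n) := fun n => Function.iterate_succ_apply' _ n x
  have hsK : ∀ n, s n ∈ Set.Icc 0 K := by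
    intro n
    induction n with
    | zero => exact ⟨hx0, hx⟩
    | succ n ih => rw [hs]; exact hgs _ ih
  let d : ℕ → ℝ := fun n => g (s n)
  have hdm : ∀ k, d k ∈ ({0, 1, m} : Set ℝ) := fun k => hg _
  have hd := digit_bounds hm hdm
  refine ⟨d, hdm, ?_⟩
  have key : ∀ n, piR β d - x = (piR β (fun i => d (i + n)) - s n) / β ^ n := by
    intro n
    induction n with
    | zero => simp [s]
    | succ n ih =>
      have h1 := piR_succ hβ fun i => hd (i + n)
      simp only [zero_add, add_assoc, add_comm 1 n] at h1
      rw [ih, h1, hs, pow_succ]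
      change _ = (_ - (β * s n - d n)) / _
      field_simp
      ring
  have bound : ∀ n, |piR β d - x| ≤ K / β ^ n := by
    intro n
    rw [key n, abs_div, abs_of_pos (a := β ^ n) (by positivity)]
    have h1 : 0 ≤ piR β (fun i => d (i + n)) := piR_nonneg hβ fun i => (hd _).1
    have h2 : piR β (fun i => d (i + n)) ≤ K := piR_le hβ fun i => hd _
    have h3 := hsK n
    gcongr
    rw [abs_le]
    constructor <;> linarith [h3.1, h3.2]
  have lim : Filter.Tendsto (fun n : ℕ => K / β ^ n) Filter.atTop (nhds 0) :=
    (tendsto_pow_atTop_atTop_of_one_lt hβ).const_div_atTop K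
  have h0 : |piR β d - x| ≤ 0 := ge_of_tendsto' lim bound
  exact sub_eq_zero.1 (abs_nonpos_iff.1 h0)

end Expansions

/-! ### Characterisation of unique binary expansions -/

/-- All tails of the binary word `y` satisfy the bounds characterising unique
expansions over `{0,1,m}`, with margin `ε`. -/
def Admissible (β m ε : ℝ) (y : ℕ → Bool) : Prop :=
  ∀ k, (y k = false → piR β (bR fun i => y (i + (k + 1))) ≤ 1 - ε) ∧
    (y k = true → m / (β - 1) - 1 + ε ≤ piR β (bR fun i => y (i + (k + 1))) ∧
      piR β (bR fun i => y (i + (k + 1))) ≤ m - 1 - ε)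

theorem Admissible.mem_Uset {β m ε : ℝ} {y : ℕ → Bool} (hβ : 1 < β) (hm : 1 < m)
    (hε : 0 < ε) (hy : Admissible β m ε y) : bR y ∈ Uset β {0, 1, m} := by
  refine ⟨bR_mem m y, fun v hv hne heq => ?_⟩
  obtain ⟨k, hk, hkne⟩ := exists_first_ne hne
  have hvb := digit_bounds hm hv
  have hyb := digit_bounds hm (bR_mem m y)
  have h := piR_sub_of_agree_succ hβ hvb hyb hk
  rw [heq, sub_self, eq_comm, div_eq_zero_iff, or_iff_left (by positivity)] at h
  have h0 : 0 ≤ piR β (fun i => v (i + (k + 1))) := piR_nonneg hβ fun i => (hvb _).1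
  have h1 : piR β (fun i => v (i + (k + 1))) ≤ m / (β - 1) := piR_le hβ fun i => hvb _
  obtain ⟨hy0, hy1⟩ := hy k
  change v k + _ - (bR y k + piR β (bR fun i => y (i + (k + 1)))) = 0 at h
  have hvk := hv k
  simp only [Set.mem_insert_iff, Set.mem_singleton_iff] at hvk
  cases hyk : y k with
  | false =>
    have hb : bR y k = 0 := by simp [bR, hyk]
    have := hy0 hyk
    rcases hvk with c | c | c
    · exact hkne (c.trans hb.symm)
    · linarith
    · linarith
  | true =>
    have hb : bR y k = 1 := by simp [bR, hyk]
    have := hy1 hyk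
    rcases hvk with c | c | c
    · linarith
    · exact hkne (c.trans hb.symm)
    · linarith

theorem admissible_zero_of_mem_Uset {β m : ℝ} {y : ℕ → Bool} (hβ : 1 < β) (hm : 1 < m)
    (hm2 : m ≤ 2) (hβm : β ≤ 1 + m) (hy : bR y ∈ Uset β {0, 1, m}) : Admissible β m 0 y := by
  intro k
  set t := piR β (bR fun i => y (i + (k + 1))) with ht
  have ht0 : 0 ≤ t := piR_nonneg hβ fun i => (bR_bounds _ i).1
  have htM : t ≤ m / (β - 1) :=
    piR_le hβ fun i => digit_bounds hm (bR_mem m fun i => y (i + (k + 1))) i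
  have key : ∀ a ∈ ({0, 1, m} : Set ℝ), a ≠ bR y k →
      ¬ (0 ≤ bR y k + t - a ∧ bR y k + t - a ≤ m / (β - 1)) := by
    rintro a ha hak ⟨h0, h1⟩
    obtain ⟨e, he, hpe⟩ := exists_expansion hm hm2 hβ hβm h0 h1
    let v : ℕ → ℝ := fun i => if i < k then bR y i else if i = k then a else e (i - (k + 1))
    have hv : ∀ i, v i ∈ ({0, 1, m} : Set ℝ) := by
      intro i
      simp only [v]
      split_ifs
      · exact bR_mem m y i
      · exact ha
      · exact he _
    have hvk : v k = a := by simp [v]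
    have hvt : (fun i => v (i + (k + 1))) = e := by
      ext i
      have h2 : ¬ i + (k + 1) < k := by omega
      have h3 : i + (k + 1) ≠ k := by omega
      simp only [v, if_neg h2, if_neg h3, Nat.add_sub_cancel]
    refine hy.2 v hv (fun h => hak (hvk ▸ congrFun h k)) ?_
    have h2 := piR_sub_of_agree_succ hβ (digit_bounds hm hv) (digit_bounds hm (bR_mem m y))
      (k := k) fun i hi => by simp [v, hi]
    change _ = (v k + _ - (bR y k + t)) / _ at h2
    rw [hvt, hvk, hpe] at h2
    rw [← sub_eq_zero, h2]
    simp
  constructor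
  · intro hyk
    have hb : bR y k = 0 := by simp [bR, hyk]
    by_contra hc
    refine key 1 (by simp) (by rw [hb]; exact one_ne_zero) ?_
    rw [hb]
    constructor <;> linarith
  · intro hyk
    have hb : bR y k = 1 := by simp [bR, hyk]
    constructor
    · by_contra hc
      refine key 0 (by simp) (by rw [hb]; exact zero_ne_one) ?_
      rw [hb]
      constructor <;> linarith
    · by_contra hc
      refine key m (by simp) (by rw [hb]; exact hm.ne') ?_
      rw [hb]
      constructor <;> linarith

theorem piR_bR_not {β : ℝ} (hβ : 1 < β) (y : ℕ → Bool) :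
    piR β (bR y) = 1 / (β - 1) - piR β (bR fun i => !y i) := by
  rw [eq_sub_iff_add_eq, ← (hasSum_const_div_pow hβ 1).tsum_eq, piR, piR,
    ← (summable_digits hβ (bR_bounds y)).tsum_add (summable_digits hβ (bR_bounds _))]
  refine tsum_congr fun k => ?_
  cases h : y k <;> simp [bR, h]

/-- Admissibility in a base implies admissibility with a uniform margin in any larger base. -/
theorem exists_margin {β β' m : ℝ} (hβ' : 1 < β') (h : β' < β) (hm : 1 < m) :
    ∃ ε > 0, ∀ y, Admissible β' m 0 y → Admissible β m ε y := by
  have hβ : 1 < β := hβ'.trans h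
  set q := β' / β with hq
  have hq0 : 0 < q := by positivity
  have hq1 : q < 1 := (div_lt_one (by linarith)).2 h
  have h3 : (m - 1) / (β - 1) < (m - 1) / (β' - 1) :=
    div_lt_div_of_pos_left (by linarith) (by linarith) (by linarith)
  have split : ∀ b : ℝ, 1 < b → m / (b - 1) = 1 / (b - 1) + (m - 1) / (b - 1) := by
    intro b _
    rw [← add_div]
    ring
  refine ⟨min (min (1 - q) ((1 - q) * (m - 1))) ((m - 1) / (β' - 1) - (m - 1) / (β - 1)),
    lt_min (lt_min (by linarith) (mul_pos (by linarith) (by linarith))) (by linarith),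
    fun y hy k => ?_⟩
  set ε := min (min (1 - q) ((1 - q) * (m - 1))) ((m - 1) / (β' - 1) - (m - 1) / (β - 1))
  have e1 : ε ≤ 1 - q := (min_le_left _ _).trans (min_le_left _ _)
  have e2 : ε ≤ (1 - q) * (m - 1) := (min_le_left _ _).trans (min_le_right _ _)
  have e3 : ε ≤ (m - 1) / (β' - 1) - (m - 1) / (β - 1) := min_le_right _ _
  obtain ⟨hy0, hy1⟩ := hy k
  have ht := piR_le_mul_piR hβ' h.le (bR_bounds fun i => y (i + (k + 1)))
  constructor
  · intro hk
    have := mul_le_mul_of_nonneg_left (hy0 hk) hq0.le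
    linarith
  · intro hk
    obtain ⟨ha, hb⟩ := hy1 hk
    constructor
    · have hc := piR_le_mul_piR hβ' h.le (bR_bounds fun i => !y (i + (k + 1)))
      have hn : 0 ≤ piR β' (bR fun i => !y (i + (k + 1))) :=
        piR_nonneg hβ' fun i => (bR_bounds _ i).1
      have hc' : q * piR β' (bR fun i => !y (i + (k + 1))) ≤
          piR β' (bR fun i => !y (i + (k + 1))) := mul_le_of_le_one_left hn hq1.le
      rw [piR_bR_not hβ', split β' hβ'] at ha
      rw [piR_bR_not hβ, split β hβ]
      linarith
    · have := mul_le_mul_of_nonneg_left hb hq0.le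
      linarith

theorem exists_pow_small {β ε : ℝ} (hβ : 1 < β) (hε : 0 < ε) :
    ∃ N : ℕ, 1 / (β - 1) / β ^ N ≤ ε := by
  have lim : Filter.Tendsto (fun n : ℕ => 1 / (β - 1) / β ^ n) Filter.atTop (nhds 0) :=
    (tendsto_pow_atTop_atTop_of_one_lt hβ).const_div_atTop _
  exact ((lim.eventually (gt_mem_nhds hε)).exists).imp fun _ h => h.le

/-- A word whose long factors all occur in uniformly admissible words is admissible. -/
theorem admissible_of_windows {β m ε : ℝ} {N : ℕ} (hβ : 1 < β)
    (hN : 1 / (β - 1) / β ^ N ≤ ε) {y : ℕ → Bool}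
    (hy : ∀ k, ∃ z, Admissible β m (2 * ε) z ∧ ∀ i < N + 1, y (k + i) = z i) :
    Admissible β m ε y := by
  intro k
  obtain ⟨z, hz, hzy⟩ := hy k
  obtain ⟨hz0, hz1⟩ := hz 0
  simp only [zero_add] at hz0 hz1
  have hk : y k = z 0 := hzy 0 (by omega)
  have hd := piR_sub_of_agree hβ (bR_bounds fun i => y (i + (k + 1)))
    (bR_bounds fun i => z (i + 1)) (k := N) fun i hi => by
      have := hzy (i + 1) (by omega)
      rw [← add_assoc, add_comm k i, add_assoc] at this
      simp only [bR, this]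
  have habs : |piR β (bR fun i => y (i + (k + 1))) - piR β (bR fun i => z (i + 1))| ≤ ε := by
    refine le_trans ?_ hN
    rw [hd, abs_div, abs_of_pos (a := β ^ N) (by positivity)]
    have b1 := piR_le hβ fun i => bR_bounds (fun i => y (i + (k + 1))) (i + N)
    have b2 := piR_le hβ fun i => bR_bounds (fun i => z (i + 1)) (i + N)
    have b3 := piR_nonneg hβ fun i => (bR_bounds (fun i => y (i + (k + 1))) (i + N)).1
    have b4 := piR_nonneg hβ fun i => (bR_bounds (fun i => z (i + 1)) (i + N)).1
    gcongr
    rw [abs_le]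
    constructor <;> linarith
  rw [abs_le] at habs
  rw [hk]
  constructor
  · intro h
    linarith [hz0 h]
  · intro h
    have := hz1 h
    constructor <;> linarith

/-! ### Two freely concatenable words in an uncountable shift space -/

theorem exists_two_recurrent {X : Set (ℕ → Bool)} (hX : ∀ x ∈ X, ∀ k, (fun i => x (i + k)) ∈ X)
    (hunc : ¬ X.Countable) (N : ℕ) :
    ∃ x ∈ X, ∃ x' ∈ X, x ≠ x' ∧ (∀ i < N, x i = x' i) ∧
      (∀ B, ∃ a, B ≤ a ∧ ∀ i < N, x (a + i) = x i) ∧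
      ∀ B, ∃ a, B ≤ a ∧ ∀ i < N, x' (a + i) = x' i := by
  by_contra hcon
  apply hunc
  let R : (Fin N → Bool) → Set (ℕ → Bool) := fun w =>
    {x | x ∈ X ∧ (∀ i : Fin N, x i = w i) ∧ ∀ B, ∃ a, B ≤ a ∧ ∀ i : Fin N, x (a + i) = w i}
  have hR : ∀ w, (R w).Countable := by
    intro w
    refine Set.Subsingleton.countable fun x hx x' hx' => ?_
    by_contra hne
    refine hcon ⟨x, hx.1, x', hx'.1, hne,
      fun i hi => (hx.2.1 ⟨i, hi⟩).trans (hx'.2.1 ⟨i, hi⟩).symm, fun B => ?_, fun B => ?_⟩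
    · obtain ⟨a, ha, h⟩ := hx.2.2 B
      exact ⟨a, ha, fun i hi => (h ⟨i, hi⟩).trans (hx.2.1 ⟨i, hi⟩).symm⟩
    · obtain ⟨a, ha, h⟩ := hx'.2.2 B
      exact ⟨a, ha, fun i hi => (h ⟨i, hi⟩).trans (hx'.2.1 ⟨i, hi⟩).symm⟩
  have hU : (⋃ w, R w).Countable := Set.countable_iUnion hR
  have hS : ∀ k : ℕ, {x : ℕ → Bool | (fun i => x (i + k)) ∈ ⋃ w, R w}.Countable := by
    intro k
    let f : (ℕ → Bool) → (Fin k → Bool) × (ℕ → Bool) := fun x => (fun i => x i, fun i => x (i + k))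
    have hf : Function.Injective f := by
      intro x x' h
      ext i
      by_cases hi : i < k
      · have := congrFun (congrArg Prod.fst h) ⟨i, hi⟩
        simpa [f] using this
      · have := congrFun (congrArg Prod.snd h) (i - k)
        simpa [f, Nat.sub_add_cancel (not_lt.1 hi)] using this
    refine (((Set.countable_univ (α := Fin k → Bool)).prod hU).preimage_of_injOn
      hf.injOn).mono fun x hx => ?_
    exact ⟨Set.mem_univ _, hx⟩
  refine (Set.countable_iUnion hS).mono fun x hx => ?_
  obtain ⟨w, hw⟩ := Finite.exists_infinite_fiber fun (k : ℕ) (i : Fin N) => x (k + i)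
  rw [Set.infinite_coe_iff] at hw
  obtain ⟨k, hk⟩ := hw.nonempty
  refine Set.mem_iUnion.2 ⟨k, Set.mem_iUnion.2 ⟨w, hX x hx k, fun i => ?_, fun B => ?_⟩⟩
  · have := congrFun hk i
    simpa [add_comm] using this
  · obtain ⟨n, hn, hnB⟩ := hw.exists_gt (B + k)
    refine ⟨n - k, by omega, fun i => ?_⟩
    have := congrFun hn i
    simpa only [show n - k + i + k = n + i by omega] using this

/-- The concatenation of the blocks `blk (ω 0), blk (ω 1), …` of length `l`. -/
def concatBlocks (l : ℕ) (blk : Fin 2 → ℕ → Bool) (ω : ℕ → Fin 2) : ℕ → Bool :=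
  fun n => blk (ω (n / l)) (n % l)

theorem concatBlocks_mul_add (l : ℕ) (blk : Fin 2 → ℕ → Bool) (ω : ℕ → Fin 2) (n : ℕ) {j : ℕ}
    (hj : j < l) : concatBlocks l blk ω (l * n + j) = blk (ω n) j := by
  unfold concatBlocks
  rw [Nat.mul_add_div (by omega), Nat.div_eq_of_lt hj, Nat.mul_add_mod, Nat.mod_eq_of_lt hj,
    add_zero]

/-- Windows starting in a block made of a return of `x` followed by a return of `x'` are
factors of `x` or `x'`. -/
theorem window_of_returns {x x' y : ℕ → Bool} {N a b s : ℕ} (hpre : ∀ i < N, x i = x' i)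
    (hb : N ≤ b) (hxa : ∀ i < N, x (a + i) = x i) (hxb : ∀ i < N, x' (b + i) = x' i)
    (h1 : ∀ i < a, y (s + i) = x i) (h2 : ∀ i < b, y (s + (a + i)) = x' i)
    (h3 : ∀ i < N, y (s + (a + b + i)) = x' i) {j : ℕ} (hj : j < a + b) :
    (∀ i < N, y (s + j + i) = x (i + j)) ∨ ∃ k, ∀ i < N, y (s + j + i) = x' (i + k) := by
  by_cases hja : j < a
  · refine Or.inl fun i hi => ?_
    by_cases hc : j + i < a
    · rw [add_assoc, h1 _ hc, add_comm]
    · obtain ⟨c, hc'⟩ := Nat.exists_eq_add_of_le (not_lt.1 hc)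
      rw [add_assoc, hc', h2 c (by omega), add_comm i j, hc', hxa c (by omega),
        hpre c (by omega)]
  · refine Or.inr ⟨j - a, fun i hi => ?_⟩
    by_cases hc : j + i < a + b
    · rw [show s + j + i = s + (a + (i + (j - a))) by omega, h2 _ (by omega)]
    · obtain ⟨c, hc'⟩ := Nat.exists_eq_add_of_le (not_lt.1 hc)
      rw [add_assoc, hc', h3 c (by omega), show i + (j - a) = b + c by omega, hxb c (by omega)]

theorem exists_free_blocks {X : Set (ℕ → Bool)} (hX : ∀ x ∈ X, ∀ k, (fun i => x (i + k)) ∈ X)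
    (hunc : ¬ X.Countable) (N : ℕ) :
    ∃ (l : ℕ) (blk : Fin 2 → ℕ → Bool), (∃ j < l, blk 0 j ≠ blk 1 j) ∧
      ∀ ω k, ∃ z ∈ X, ∀ i < N, concatBlocks l blk ω (k + i) = z i := by
  obtain ⟨x, hx, x', hx', hne, hpre, hr, hr'⟩ := exists_two_recurrent hX hunc N
  obtain ⟨d, hd⟩ := Function.ne_iff.1 hne
  obtain ⟨a, ha, hxa⟩ := hr (max (d + 1) N)
  obtain ⟨b, hb, hxb⟩ := hr' (max (d + 1) N)
  have had : d < a := (le_max_left _ _).trans ha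
  have hbd : d < b := (le_max_left _ _).trans hb
  have haN : N ≤ a := (le_max_right _ _).trans ha
  have hbN : N ≤ b := (le_max_right _ _).trans hb
  let P : ℕ → Bool := fun i => if i < a then x i else x' (i - a)
  let Q : ℕ → Bool := fun i => if i < b then x' i else x (i - b)
  let blk : Fin 2 → ℕ → Bool := ![P, Q]
  refine ⟨a + b, blk, ⟨d, by omega, by simpa [blk, P, Q, had, hbd] using hd⟩, fun ω k => ?_⟩
  have hl : 0 < a + b := by omega
  set n := k / (a + b) with hn
  set j := k % (a + b) with hj
  have hjl : j < a + b := Nat.mod_lt _ hl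
  have hk : k = (a + b) * n + j := (Nat.div_add_mod k (a + b)).symm
  have hblk : ∀ i < a + b, concatBlocks (a + b) blk ω ((a + b) * n + i) = blk (ω n) i :=
    fun i hi => concatBlocks_mul_add _ _ _ _ hi
  have hnext : ∀ i < N, concatBlocks (a + b) blk ω ((a + b) * n + (a + b + i)) = x i := by
    intro i hi
    rw [← add_assoc, ← Nat.mul_succ, concatBlocks_mul_add _ _ _ _ (by omega)]
    match ω n.succ with
    | 0 => simp [blk, P, show i < a by omega]
    | 1 => simp [blk, Q, show i < b by omega, hpre i hi]
  rw [hk]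
  match hω : ω n with
  | 0 =>
    rw [hω] at hblk
    rcases window_of_returns (y := concatBlocks (a + b) blk ω) (s := (a + b) * n) hpre hbN hxa hxb
      (fun i hi => by rw [hblk i (by omega)]; simp [blk, P, hi])
      (fun i hi => by rw [hblk _ (by omega)]; simp [blk, P])
      (fun i hi => by rw [hnext i hi, hpre i hi]) hjl with h | ⟨c, h⟩
    · exact ⟨_, hX x hx j, h⟩
    · exact ⟨_, hX x' hx' c, h⟩
  | 1 =>
    rw [hω] at hblk
    rcases window_of_returns (y := concatBlocks (a + b) blk ω) (s := (a + b) * n) (j := j)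
      (fun i hi => (hpre i hi).symm) haN hxb hxa
      (fun i hi => by rw [hblk i (by omega)]; simp [blk, Q, hi])
      (fun i hi => by rw [hblk _ (by omega)]; simp [blk, Q])
      (fun i hi => by rw [add_comm b a, hnext i hi]) (by omega) with h | ⟨c, h⟩
    · exact ⟨_, hX x' hx' j, h⟩
    · exact ⟨_, hX x hx c, h⟩

/-! ### Lower bound for the Hausdorff dimension -/

theorem dimH_range_pos_of_separated {β ε : ℝ} {l : ℕ} (hβ : 1 < β) (hε : 0 < ε) (hl : 0 < l)
    (F : (ℕ → Fin 2) → ℝ)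
    (hF : ∀ ω ω' n, (∀ i < n, ω i = ω' i) → ω n ≠ ω' n →
      ε / β ^ (l * (n + 1)) ≤ |F ω - F ω'|) : 0 < dimH (Set.range F) := by
  have hFinj : Function.Injective F := by
    intro ω ω' h
    by_contra hne
    obtain ⟨n, hn, hnn⟩ := exists_first_ne hne
    have := hF ω ω' n hn hnn
    rw [h, sub_self, abs_zero] at this
    exact absurd this (not_le.2 (by positivity))
  have hlogβ : 0 < Real.log β := Real.log_pos hβ
  have hlog2 : 0 < Real.log 2 := Real.log_pos one_lt_two
  set r : ℝ := Real.log 2 / (l * Real.log β) with hr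
  have hr0 : 0 < r := by positivity
  have hpow : ∀ n : ℕ, (β ^ (l * n)) ^ r = (2 : ℝ) ^ n := by
    intro n
    rw [Real.rpow_def_of_pos (by positivity), Real.log_pow, ← Real.rpow_natCast 2 n,
      Real.rpow_def_of_pos two_pos]
    congr 1
    rw [hr]
    push_cast
    field_simp
  set C : ℝ := 2 / ε ^ r with hC
  have hC0 : 0 < C := by positivity
  have hold : ∀ ω ω', |Real.ofDigits ω - Real.ofDigits ω'| ≤ C * |F ω - F ω'| ^ r := by
    intro ω ω'
    by_cases hne : ω = ω'
    · rw [hne, sub_self, abs_zero]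
      positivity
    obtain ⟨n, hn, hnn⟩ := exists_first_ne hne
    have h1 := Real.rpow_le_rpow (by positivity) (hF ω ω' n hn hnn) hr0.le
    rw [Real.div_rpow hε.le (by positivity), hpow] at h1
    calc |Real.ofDigits ω - Real.ofDigits ω'| ≤ (((2 : ℕ) : ℝ) ^ n)⁻¹ :=
          Real.abs_ofDigits_sub_ofDigits_le hn
      _ = C * (ε ^ r / 2 ^ (n + 1)) := by
          have : ε ^ r ≠ 0 := by positivity
          rw [hC, pow_succ]
          push_cast
          field_simp
      _ ≤ C * |F ω - F ω'| ^ r := by gcongr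
  let g : ℝ → ℝ := fun t => Real.ofDigits (Function.invFun F t)
  have hg : ∀ ω, g (F ω) = Real.ofDigits ω := fun ω => by
    simp only [g, Function.leftInverse_invFun hFinj ω]
  have hgH : HolderOnWith C.toNNReal r.toNNReal g (Set.range F) := by
    rintro _ ⟨ω, rfl⟩ _ ⟨ω', rfl⟩
    rw [hg, hg, edist_dist, edist_dist, Real.dist_eq, Real.dist_eq,
      Real.coe_toNNReal _ hr0.le, ENNReal.ofReal_rpow_of_nonneg (abs_nonneg _) hr0.le]
    change _ ≤ ENNReal.ofReal C * _
    rw [← ENNReal.ofReal_mul hC0.le]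
    exact ENNReal.ofReal_le_ofReal (hold ω ω')
  have hdim := hgH.dimH_image_le (Real.toNNReal_pos.2 hr0)
  have himg : Set.Icc (0 : ℝ) 1 ⊆ g '' Set.range F := by
    intro t ht
    obtain ⟨ω, -, rfl⟩ := Real.ofDigits_SurjOn one_lt_two ht
    exact ⟨F ω, ⟨ω, rfl⟩, hg ω⟩
  have hone : dimH (Set.Icc (0 : ℝ) 1) = 1 := by
    rw [Real.dimH_of_nonempty_interior ⟨1 / 2, by rw [interior_Icc]; norm_num⟩]
    simp
  by_contra hzero
  rw [not_lt, nonpos_iff_eq_zero] at hzero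
  rw [hzero, ENNReal.zero_div] at hdim
  have := (dimH_mono himg).trans hdim
  rw [hone] at this
  exact absurd this (by simp)

/-- Distinct admissible words have well separated values. -/
theorem Admissible.separated {β m ε : ℝ} {y y' : ℕ → Bool} (hβ : 1 < β)
    (hy : Admissible β m ε y) (hy' : Admissible β m ε y') {k : ℕ} (hk : ∀ i < k, y i = y' i)
    (hne : y k ≠ y' k) : ε / β ^ (k + 1) ≤ |piR β (bR y) - piR β (bR y')| := by
  have h := piR_sub_of_agree_succ hβ (bR_bounds y) (bR_bounds y') (k := k) fun i hi => by
    simp only [bR, hk i hi]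
  change _ = (bR y k + piR β (bR fun i => y (i + (k + 1))) -
    (bR y' k + piR β (bR fun i => y' (i + (k + 1))))) / _ at h
  rw [h, abs_div, abs_of_pos (a := β ^ (k + 1)) (by positivity)]
  have n1 : 0 ≤ piR β (bR fun i => y (i + (k + 1))) := piR_nonneg hβ fun i => (bR_bounds _ i).1
  have n2 : 0 ≤ piR β (bR fun i => y' (i + (k + 1))) := piR_nonneg hβ fun i => (bR_bounds _ i).1
  gcongr
  have b0 : ∀ {u : ℕ → Bool}, u k = false → bR u k = 0 := fun h => by simp [bR, h]
  have b1 : ∀ {u : ℕ → Bool}, u k = true → bR u k = 1 := fun h => by simp [bR, h]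
  cases hyk : y k <;> cases hyk' : y' k
  · exact absurd (hyk.trans hyk'.symm) hne
  · have := (hy k).1 hyk
    rw [abs_sub_comm]
    refine le_trans ?_ (le_abs_self _)
    linarith [b0 hyk, b1 hyk']
  · have := (hy' k).1 hyk'
    refine le_trans ?_ (le_abs_self _)
    linarith [b1 hyk, b0 hyk']
  · exact absurd (hyk.trans hyk'.symm) hne

theorem dimH_pos_of_free_blocks {β m ε : ℝ} {l : ℕ} {blk : Fin 2 → ℕ → Bool} (hβ : 1 < β)
    (hm : 1 < m) (hε : 0 < ε) (hne : ∃ j < l, blk 0 j ≠ blk 1 j)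
    (hadm : ∀ ω, Admissible β m ε (concatBlocks l blk ω)) :
    0 < dimH (piR β '' (Uset β {0, 1, m} ∩ {v | ∃ u : ℕ → Bool, v = bR u})) := by
  obtain ⟨j, hj, hjne⟩ := hne
  refine (dimH_range_pos_of_separated hβ hε (l := l) (by omega)
    (fun ω => piR β (bR (concatBlocks l blk ω))) fun ω ω' n hn hnn => ?_).trans_le
    (dimH_mono ?_)
  · have hd : concatBlocks l blk ω ≠ concatBlocks l blk ω' := by
      intro h
      have h1 := congrFun h (l * n + j)
      rw [concatBlocks_mul_add _ _ _ _ hj, concatBlocks_mul_add _ _ _ _ hj] at h1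
      match h2 : ω n, h3 : ω' n with
      | 0, 0 => exact hnn (h2.trans h3.symm)
      | 1, 1 => exact hnn (h2.trans h3.symm)
      | 0, 1 => rw [h2, h3] at h1; exact hjne h1
      | 1, 0 => rw [h2, h3] at h1; exact hjne h1.symm
    obtain ⟨k, hk, hkne⟩ := exists_first_ne hd
    have hkl : k < l * (n + 1) := by
      by_contra hc
      have h1 := hk (l * n + j) (by rw [not_lt, Nat.mul_succ] at hc; omega)
      rw [concatBlocks_mul_add _ _ _ _ hj, concatBlocks_mul_add _ _ _ _ hj] at h1
      match h2 : ω n, h3 : ω' n with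
      | 0, 0 => exact hnn (h2.trans h3.symm)
      | 1, 1 => exact hnn (h2.trans h3.symm)
      | 0, 1 => rw [h2, h3] at h1; exact hjne h1
      | 1, 0 => rw [h2, h3] at h1; exact hjne h1.symm
    refine le_trans ?_ ((hadm ω).separated hβ (hadm ω') hk hkne)
    exact div_le_div_of_nonneg_left hε.le (by positivity)
      (pow_le_pow_right₀ hβ.le (Nat.succ_le_of_lt hkl))
  · rintro _ ⟨ω, rfl⟩
    exact ⟨_, ⟨(hadm ω).mem_Uset hβ hm hε, _, rfl⟩, rfl⟩

/-- In bases larger than `1 + m`, words with sparse ones have unique expansions. -/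
theorem dimH_pos_of_large {β m : ℝ} (hm : 1 < m) (hβ : 1 + m < β) :
    0 < dimH (piR β '' (Uset β {0, 1, m} ∩ {v | ∃ u : ℕ → Bool, v = bR u})) := by
  have hβ1 : 1 < β := by linarith
  have hq : m / (β - 1) < 1 := (div_lt_one (by linarith)).2 (by linarith)
  have hq' : 1 / (β - 1) ≤ m / (β - 1) :=
    div_le_div_of_nonneg_right hm.le (by linarith)
  set ε := min (1 - m / (β - 1)) ((m - 1) / 2) with hε
  have e1 : ε ≤ 1 - m / (β - 1) := min_le_left _ _
  have e2 : ε ≤ (m - 1) / 2 := min_le_right _ _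
  have hε0 : 0 < ε := lt_min (by linarith) (by linarith)
  obtain ⟨N, hN⟩ := exists_pow_small hβ1 hε0
  refine dimH_pos_of_free_blocks (l := N + 1)
    (blk := ![fun _ => false, fun i => decide (i = 0)]) hβ1 hm hε0 ⟨0, by omega, by simp⟩
    fun ω k => ?_
  set y := concatBlocks (N + 1) ![fun _ => false, fun i => decide (i = 0)] ω with hy
  have h0 : 0 ≤ piR β (bR fun i => y (i + (k + 1))) :=
    piR_nonneg hβ1 fun i => (bR_bounds _ i).1
  have h1 : piR β (bR fun i => y (i + (k + 1))) ≤ 1 / (β - 1) :=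
    piR_le hβ1 (bR_bounds _)
  have hone : ∀ n, y n = true → n % (N + 1) = 0 := by
    intro n hn
    simp only [hy, concatBlocks] at hn
    match h2 : ω (n / (N + 1)) with
    | 0 => simp [h2] at hn
    | 1 => simpa [h2] using hn
  refine ⟨fun _ => by linarith, fun hk => ⟨by linarith, ?_⟩⟩
  have hz : ∀ i < N, bR (fun i => y (i + (k + 1))) i = 0 := by
    intro i hi
    have : y (i + (k + 1)) ≠ true := by
      intro hc
      have d1 := Nat.dvd_of_mod_eq_zero (hone _ hc)
      have d2 := Nat.dvd_of_mod_eq_zero (hone _ hk)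
      rw [show i + (k + 1) = k + (i + 1) by omega, Nat.dvd_add_right d2] at d1
      exact absurd (Nat.le_of_dvd (by omega) d1) (by omega)
    simp [bR, this]
  have hs := piR_split hβ1 (bR_bounds fun i => y (i + (k + 1))) N
  rw [Finset.sum_eq_zero fun i hi => by rw [hz i (Finset.mem_range.1 hi), zero_div], zero_add] at hs
  have h2 : piR β (fun i => bR (fun i => y (i + (k + 1))) (i + N)) ≤ 1 / (β - 1) :=
    piR_le hβ1 fun i => bR_bounds _ _
  have h3 := div_le_div_of_nonneg_right h2 (pow_nonneg (by linarith : (0 : ℝ) ≤ β) N)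
  linarith

theorem dimH_pos_of_uncountable {β β' m : ℝ} (hm : 1 < m) (hm2 : m ≤ 2) (hβ' : 1 < β')
    (h : β' < β) (hβm : β' ≤ 1 + m)
    (hunc : ¬ (Uset β' {0, 1, m} ∩ {v | ∃ u : ℕ → Bool, v = bR u}).Countable) :
    0 < dimH (piR β '' (Uset β {0, 1, m} ∩ {v | ∃ u : ℕ → Bool, v = bR u})) := by
  have hβ : 1 < β := hβ'.trans h
  obtain ⟨ε, hε, hX⟩ := exists_margin hβ' h hm
  obtain ⟨N, hN⟩ := exists_pow_small hβ (half_pos hε)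
  have hXunc : ¬ {y | Admissible β' m 0 y}.Countable := by
    refine fun hc => hunc ((hc.image bR).mono ?_)
    rintro _ ⟨hu, y, rfl⟩
    exact ⟨y, admissible_zero_of_mem_Uset hβ' hm hm2 hβm hu, rfl⟩
  obtain ⟨l, blk, hne, hwin⟩ := exists_free_blocks (X := {y | Admissible β' m 0 y})
    (fun x hx k n => by
      have := hx (n + k)
      simpa only [add_assoc, add_comm k 1, add_left_comm k] using this) hXunc (N + 1)
  refine dimH_pos_of_free_blocks hβ hm (half_pos hε) hne fun ω =>
    admissible_of_windows hβ hN fun k => ?_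
  obtain ⟨z, hz, hzy⟩ := hwin ω k
  exact ⟨z, by rw [mul_div_cancel₀ ε two_ne_zero]; exact hX z hz, hzy⟩

/-- For every `m ∈ (1,2]` and every `β > 𝓛(m)`, the Hausdorff dimension of
`π_β(U_β(m)) ⊆ ℝ` is positive. -/
theorem dimH_pos_above_L (m : ℝ) (hm : m ∈ Set.Ioc (1 : ℝ) 2) (β : ℝ) (hβ : Lval m < β) :
    0 < dimH (piR β '' Uset β {0, 1, m}) := by
  obtain ⟨hm1, hm2⟩ := hm
  suffices h : 0 < dimH (piR β '' (Uset β {0, 1, m} ∩ {v | ∃ u : ℕ → Bool, v = bR u})) from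
    h.trans_le (dimH_mono (Set.image_mono Set.inter_subset_left))
  have hne : {β : ℝ | 1 < β ∧
      ¬ (Uset β {0, 1, m} ∩ {v | ∃ u : ℕ → Bool, v = bR u}).Countable}.Nonempty :=
    ⟨2 + m, by linarith, fun hc =>
      (dimH_pos_of_large hm1 (by linarith : 1 + m < 2 + m)).ne' (dimH_countable (hc.image _))⟩
  obtain ⟨β', ⟨hβ'1, hunc⟩, hlt⟩ := exists_lt_of_csInf_lt hne hβ
  rcases le_or_gt β' (1 + m) with hle | hgt
  · exact dimH_pos_of_uncountable hm1 hm2 hβ'1 hlt hle hunc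
  · exact dimH_pos_of_large hm1 (hgt.trans hlt)
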